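/- arXiv:solv-int/9701008 — 3 statements merged into one kernel-verified Lean document; each statement's English description precedes it below -/
import Mathlib

section
/- Let w : ℝ³ → ℝ be a smooth solution of the PKP equation and let f : ℝ → ℝ be smooth. Define Q : ℝ³ → ℝ by Q = f(t)∂_t w + (2/3)y f'(t)∂_y w + ((1/3)x f'(t) + (2/9)y² f''(t))∂ₓ w + (1/3)w f'(t) + (1/9)x² f''(t) + (4/27)x y² f'''(t) + (4/243)y⁴ f''''(t). Then Q satisfies the linearized PKP equation at w; that is, the Virasoro (time-reparametrization) flow T(f) is a symmetry of the PKP equation for every smooth f. -/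
noncomputable section

/-- Partial derivative in the first variable `x`. -/
def dx (w : ℝ → ℝ → ℝ → ℝ) : ℝ → ℝ → ℝ → ℝ :=
  fun x y t => deriv (fun s => w s y t) x

/-- Partial derivative in the second variable `y`. -/
def dy (w : ℝ → ℝ → ℝ → ℝ) : ℝ → ℝ → ℝ → ℝ :=
  fun x y t => deriv (fun s => w x s t) y

/-- Partial derivative in the third variable `t`. -/
def dt (w : ℝ → ℝ → ℝ → ℝ) : ℝ → ℝ → ℝ → ℝ :=
  fun x y t => deriv (fun s => w x y s) t

/-- Smoothness of a function of three real variables. -/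
def Smooth3 (w : ℝ → ℝ → ℝ → ℝ) : Prop :=
  ContDiff ℝ (⊤ : ℕ∞) (fun p : ℝ × ℝ × ℝ => w p.1 p.2.1 p.2.2)

/-- The potential Kadomtsev–Petviashvili equation. -/
def PKP (w : ℝ → ℝ → ℝ → ℝ) : Prop :=
  ∀ x y t, dx (dt w) x y t =
      (1/4) * dx (dx (dx (dx w))) x y t
    + (3/2) * dx w x y t * dx (dx w) x y t
    + (3/4) * dy (dy w) x y t

/-- The linearization of the PKP equation at a solution `w`. -/
def LinPKP (w Q : ℝ → ℝ → ℝ → ℝ) : Prop :=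
  ∀ x y t, dx (dt Q) x y t =
      (1/4) * dx (dx (dx (dx Q))) x y t
    + (3/2) * (dx Q x y t * dx (dx w) x y t + dx w x y t * dx (dx Q) x y t)
    + (3/4) * dy (dy Q) x y t

/-- A function of three variables, viewed as a function on the product space. -/
def uncurry3 (u : ℝ → ℝ → ℝ → ℝ) : ℝ × ℝ × ℝ → ℝ := fun p => u p.1 p.2.1 p.2.2

/-- Directional derivative along a fixed vector. -/
def dirDeriv (v : ℝ × ℝ × ℝ) (u : ℝ → ℝ → ℝ → ℝ) : ℝ → ℝ → ℝ → ℝ :=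
  fun x y t => fderiv ℝ (uncurry3 u) (x, y, t) v

namespace Smooth3

variable {a b : ℝ → ℝ → ℝ → ℝ}

lemma contDiff (ha : Smooth3 a) : ContDiff ℝ (⊤ : ℕ∞) (uncurry3 a) := ha

lemma differentiableAt (ha : Smooth3 a) (p : ℝ × ℝ × ℝ) :
    DifferentiableAt ℝ (uncurry3 a) p :=
  (ha.contDiff.differentiable (by simp)) p

lemma hasDerivAt_x (ha : Smooth3 a) (x y t : ℝ) :
    HasDerivAt (fun s => a s y t) (dirDeriv (1, 0, 0) a x y t) x :=
  (ha.differentiableAt (x, y, t)).hasFDerivAt.comp_hasDerivAt (f := fun s => (s, y, t)) x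
    ((hasDerivAt_id x).prodMk ((hasDerivAt_const x y).prodMk (hasDerivAt_const x t)))

lemma hasDerivAt_y (ha : Smooth3 a) (x y t : ℝ) :
    HasDerivAt (fun s => a x s t) (dirDeriv (0, 1, 0) a x y t) y :=
  (ha.differentiableAt (x, y, t)).hasFDerivAt.comp_hasDerivAt (f := fun s => (x, s, t)) y
    ((hasDerivAt_const y x).prodMk ((hasDerivAt_id y).prodMk (hasDerivAt_const y t)))

lemma hasDerivAt_t (ha : Smooth3 a) (x y t : ℝ) :
    HasDerivAt (fun s => a x y s) (dirDeriv (0, 0, 1) a x y t) t :=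
  (ha.differentiableAt (x, y, t)).hasFDerivAt.comp_hasDerivAt (f := fun s => (x, y, s)) t
    ((hasDerivAt_const t x).prodMk ((hasDerivAt_const t y).prodMk (hasDerivAt_id t)))

lemma dx_eq (ha : Smooth3 a) : _root_.dx a = dirDeriv (1, 0, 0) a := by
  ext x y t
  exact (ha.hasDerivAt_x x y t).deriv

lemma dy_eq (ha : Smooth3 a) : _root_.dy a = dirDeriv (0, 1, 0) a := by
  ext x y t
  exact (ha.hasDerivAt_y x y t).deriv

lemma dt_eq (ha : Smooth3 a) : _root_.dt a = dirDeriv (0, 0, 1) a := by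
  ext x y t
  exact (ha.hasDerivAt_t x y t).deriv

lemma dirDeriv (ha : Smooth3 a) (v : ℝ × ℝ × ℝ) : Smooth3 (dirDeriv v a) :=
  (ha.contDiff.fderiv_right (m := (⊤ : ℕ∞)) (by simp)).clm_apply contDiff_const

lemma dx (ha : Smooth3 a) : Smooth3 (dx a) := ha.dx_eq ▸ ha.dirDeriv _

lemma dy (ha : Smooth3 a) : Smooth3 (dy a) := ha.dy_eq ▸ ha.dirDeriv _

lemma dt (ha : Smooth3 a) : Smooth3 (dt a) := ha.dt_eq ▸ ha.dirDeriv _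

lemma dirDeriv_comm (ha : Smooth3 a) (v v' : ℝ × ℝ × ℝ) :
    _root_.dirDeriv v (_root_.dirDeriv v' a) = _root_.dirDeriv v' (_root_.dirDeriv v a) := by
  have hd : Differentiable ℝ (fderiv ℝ (uncurry3 a)) :=
    (ha.contDiff.fderiv_right (m := (⊤ : ℕ∞)) (by simp)).differentiable (by simp)
  have key (u u' : ℝ × ℝ × ℝ) (p : ℝ × ℝ × ℝ) :
      fderiv ℝ (fun q => fderiv ℝ (uncurry3 a) q u') p u
        = fderiv ℝ (fderiv ℝ (uncurry3 a)) p u u' := by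
    rw [fderiv_clm_apply (hd p) (differentiableAt_const _)]
    simp
  ext x y t
  have hsymm : IsSymmSndFDerivAt ℝ (uncurry3 a) (x, y, t) :=
    ha.contDiff.contDiffAt.isSymmSndFDerivAt
      (by simpa using WithTop.coe_le_coe.2 (le_top : (2 : ℕ∞) ≤ ⊤))
  exact (key v v' (x, y, t)).trans ((hsymm v v').trans (key v' v (x, y, t)).symm)

lemma dy_dx (ha : Smooth3 a) : _root_.dy (_root_.dx a) = _root_.dx (_root_.dy a) := by
  rw [ha.dx.dy_eq, ha.dx_eq, ha.dy.dx_eq, ha.dy_eq, ha.dirDeriv_comm]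

lemma dt_dx (ha : Smooth3 a) : _root_.dt (_root_.dx a) = _root_.dx (_root_.dt a) := by
  rw [ha.dx.dt_eq, ha.dx_eq, ha.dt.dx_eq, ha.dt_eq, ha.dirDeriv_comm]

lemma dt_dy (ha : Smooth3 a) : _root_.dt (_root_.dy a) = _root_.dy (_root_.dt a) := by
  rw [ha.dy.dt_eq, ha.dy_eq, ha.dt.dy_eq, ha.dt_eq, ha.dirDeriv_comm]

lemma add (ha : Smooth3 a) (hb : Smooth3 b) : Smooth3 (fun x y t => a x y t + b x y t) :=
  ContDiff.add ha hb

lemma mul (ha : Smooth3 a) (hb : Smooth3 b) : Smooth3 (fun x y t => a x y t * b x y t) :=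
  ContDiff.mul ha hb

lemma const (c : ℝ) : Smooth3 (fun _ _ _ => c) := contDiff_const

lemma fst : Smooth3 (fun x _ _ => x) := contDiff_fst

lemma snd : Smooth3 (fun _ y _ => y) := contDiff_snd.fst

lemma time {g : ℝ → ℝ} (hg : ContDiff ℝ (⊤ : ℕ∞) g) : Smooth3 (fun _ _ t => g t) :=
  hg.comp contDiff_snd.snd

lemma dx_add (ha : Smooth3 a) (hb : Smooth3 b) :
    _root_.dx (fun x y t => a x y t + b x y t)
      = fun x y t => _root_.dx a x y t + _root_.dx b x y t := by
  ext x y t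
  rw [ha.dx_eq, hb.dx_eq]
  exact ((ha.hasDerivAt_x x y t).add (hb.hasDerivAt_x x y t)).deriv

lemma dx_mul (ha : Smooth3 a) (hb : Smooth3 b) :
    _root_.dx (fun x y t => a x y t * b x y t)
      = fun x y t => _root_.dx a x y t * b x y t + a x y t * _root_.dx b x y t := by
  ext x y t
  rw [ha.dx_eq, hb.dx_eq]
  exact ((ha.hasDerivAt_x x y t).mul (hb.hasDerivAt_x x y t)).deriv

lemma dy_add (ha : Smooth3 a) (hb : Smooth3 b) :
    _root_.dy (fun x y t => a x y t + b x y t)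
      = fun x y t => _root_.dy a x y t + _root_.dy b x y t := by
  ext x y t
  rw [ha.dy_eq, hb.dy_eq]
  exact ((ha.hasDerivAt_y x y t).add (hb.hasDerivAt_y x y t)).deriv

lemma dy_mul (ha : Smooth3 a) (hb : Smooth3 b) :
    _root_.dy (fun x y t => a x y t * b x y t)
      = fun x y t => _root_.dy a x y t * b x y t + a x y t * _root_.dy b x y t := by
  ext x y t
  rw [ha.dy_eq, hb.dy_eq]
  exact ((ha.hasDerivAt_y x y t).mul (hb.hasDerivAt_y x y t)).deriv

lemma dt_add (ha : Smooth3 a) (hb : Smooth3 b) :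
    _root_.dt (fun x y t => a x y t + b x y t)
      = fun x y t => _root_.dt a x y t + _root_.dt b x y t := by
  ext x y t
  rw [ha.dt_eq, hb.dt_eq]
  exact ((ha.hasDerivAt_t x y t).add (hb.hasDerivAt_t x y t)).deriv

lemma dt_mul (ha : Smooth3 a) (hb : Smooth3 b) :
    _root_.dt (fun x y t => a x y t * b x y t)
      = fun x y t => _root_.dt a x y t * b x y t + a x y t * _root_.dt b x y t := by
  ext x y t
  rw [ha.dt_eq, hb.dt_eq]
  exact ((ha.hasDerivAt_t x y t).mul (hb.hasDerivAt_t x y t)).deriv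

end Smooth3

lemma dx_const (c : ℝ) : dx (fun _ _ _ => c) = fun _ _ _ => 0 := by
  ext; simp [dx]

lemma dx_fst : dx (fun x _ _ => x) = fun _ _ _ => 1 := by
  ext; simp [dx]

lemma dx_snd : dx (fun _ y _ => y) = fun _ _ _ => 0 := by
  ext; simp [dx]

lemma dx_time (g : ℝ → ℝ) : dx (fun _ _ t => g t) = fun _ _ _ => 0 := by
  ext; simp [dx]

lemma dy_const (c : ℝ) : dy (fun _ _ _ => c) = fun _ _ _ => 0 := by
  ext; simp [dy]

lemma dy_fst : dy (fun x _ _ => x) = fun _ _ _ => 0 := by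
  ext; simp [dy]

lemma dy_snd : dy (fun _ y _ => y) = fun _ _ _ => 1 := by
  ext; simp [dy]

lemma dy_time (g : ℝ → ℝ) : dy (fun _ _ t => g t) = fun _ _ _ => 0 := by
  ext; simp [dy]

lemma dt_const (c : ℝ) : dt (fun _ _ _ => c) = fun _ _ _ => 0 := by
  ext; simp [dt]

lemma dt_fst : dt (fun x _ _ => x) = fun _ _ _ => 0 := by
  ext; simp [dt]

lemma dt_snd : dt (fun _ y _ => y) = fun _ _ _ => 0 := by
  ext; simp [dt]

lemma dt_time (g : ℝ → ℝ) : dt (fun _ _ t => g t) = fun _ _ t => deriv g t := by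
  ext; simp [dt]

/-- The Virasoro (time-reparametrization) flow `T(f)` is a symmetry of PKP. -/
theorem stmt2 (w : ℝ → ℝ → ℝ → ℝ) (hw : Smooth3 w) (hsol : PKP w)
    (f : ℝ → ℝ) (hf : ContDiff ℝ (⊤ : ℕ∞) f) :
    LinPKP w (fun x y t =>
      f t * dt w x y t
      + (2/3) * y * deriv f t * dy w x y t
      + ((1/3) * x * deriv f t + (2/9) * y ^ 2 * deriv (deriv f) t) * dx w x y t
      + (1/3) * w x y t * deriv f t + (1/9) * x ^ 2 * deriv (deriv f) t
      + (4/27) * x * y ^ 2 * deriv (deriv (deriv f)) t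
      + (4/243) * y ^ 4 * deriv (deriv (deriv (deriv f))) t) := by
  have hderiv {g : ℝ → ℝ} (hg : ContDiff ℝ (⊤ : ℕ∞) g) : ContDiff ℝ (⊤ : ℕ∞) (deriv g) :=
    (contDiff_infty_iff_deriv.1 hg).2
  have hf1 := hderiv hf
  have hf2 := hderiv hf1
  have hf3 := hderiv hf2
  have hf4 := hderiv hf3
  have hf5 := hderiv hf4
  have hE : dx (dt w) = fun x y t =>
      (1/4) * dx (dx (dx (dx w))) x y t
      + (3/2) * dx w x y t * dx (dx w) x y t
      + (3/4) * dy (dy w) x y t := by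
    ext x y t
    exact hsol x y t
  have hEx := congrArg dx hE
  have hEy := congrArg dy hE
  have hEt := congrArg dt hE
  simp (maxDischargeDepth := 20) only [dx_const, dy_const, dt_const, Smooth3.dx_add,
    Smooth3.dx_mul, Smooth3.dy_add, Smooth3.dy_mul, Smooth3.dt_add, Smooth3.dt_mul,
    Smooth3.dy_dx, Smooth3.dt_dx, Smooth3.dt_dy, Smooth3.add, Smooth3.mul, Smooth3.const,
    Smooth3.dx, Smooth3.dy, Smooth3.dt, hw] at hEx hEy hEt
  intro x y t
  have h0 := hsol x y t
  have hx := congrFun (congrFun (congrFun hEx x) y) t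
  have hy := congrFun (congrFun (congrFun hEy x) y) t
  have ht := congrFun (congrFun (congrFun hEt x) y) t
  simp (maxDischargeDepth := 20) only [pow_succ, pow_zero, one_mul, mul_one, zero_mul, mul_zero,
    zero_add, add_zero,
    dx_const, dx_fst, dx_snd, dx_time, dy_const, dy_fst, dy_snd, dy_time, dt_const,
    dt_fst, dt_snd, dt_time, Smooth3.dx_add, Smooth3.dx_mul, Smooth3.dy_add,
    Smooth3.dy_mul, Smooth3.dt_add, Smooth3.dt_mul, Smooth3.dy_dx, Smooth3.dt_dx,
    Smooth3.dt_dy, Smooth3.add, Smooth3.mul, Smooth3.const, Smooth3.fst, Smooth3.snd,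
    Smooth3.time, Smooth3.dx, Smooth3.dy, Smooth3.dt, hw, hf, hf1, hf2, hf3, hf4,
    hf5]
  linear_combination f t * ht + (2/3) * y * deriv f t * hy
    + ((1/3) * x * deriv f t + (2/9) * y ^ 2 * deriv (deriv f) t) * hx
    + (5/3) * deriv f t * h0
end
end

section
/- For all smooth f₁, f₂ : ℝ → ℝ, the Lie bracket of the vector fields T(f₁) and T(f₂) on ℝ⁴ satisfies [T(f₁), T(f₂)] = T(f₁f₂' − f₁'f₂) pointwise; in particular the fields T(f) form a centerless Virasoro (conformal) algebra. -/
noncomputable section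

/-- The space ℝ⁴, with coordinates (x, y, t, w). -/
abbrev E : Type := ℝ × ℝ × ℝ × ℝ

/-- Lie bracket of vector fields on ℝ⁴:
`[V, W](p) = DW(p)(V(p)) − DV(p)(W(p))`. -/
def lie (V W : E → E) : E → E :=
  fun p => fderiv ℝ W p (V p) - fderiv ℝ V p (W p)

/-- The Virasoro vector field `T(f)`. -/
def Tf (f : ℝ → ℝ) : E → E := fun p =>
  ((1/3) * p.1 * deriv f p.2.2.1 + (2/9) * p.2.1 ^ 2 * deriv (deriv f) p.2.2.1,
   (2/3) * p.2.1 * deriv f p.2.2.1,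
   f p.2.2.1,
   -((1/3) * p.2.2.2 * deriv f p.2.2.1 + (1/9) * p.1 ^ 2 * deriv (deriv f) p.2.2.1
     + (4/27) * p.1 * p.2.1 ^ 2 * deriv (deriv (deriv f)) p.2.2.1
     + (4/243) * p.2.1 ^ 4 * deriv (deriv (deriv (deriv f))) p.2.2.1))

/-- The Kac–Moody vector field `Y(g)`. -/
def Yf (g : ℝ → ℝ) : E → E := fun p =>
  ((2/3) * p.2.1 * deriv g p.2.2.1,
   g p.2.2.1,
   0,
   -((4/9) * p.1 * p.2.1 * deriv (deriv g) p.2.2.1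
     + (8/81) * p.2.1 ^ 3 * deriv (deriv (deriv g)) p.2.2.1))

/-- The Kac–Moody vector field `X(h)`. -/
def Xf (h : ℝ → ℝ) : E → E := fun p =>
  (h p.2.2.1, 0, 0, -((2/3) * p.1 * deriv h p.2.2.1 + (4/9) * p.2.1 ^ 2 * deriv (deriv h) p.2.2.1))

/-- The Kac–Moody vector field `W(k)`. -/
def Wf (k : ℝ → ℝ) : E → E := fun p =>
  (0, 0, 0, p.2.1 * k p.2.2.1)

/-- The Kac–Moody vector field `U(ℓ)`. -/
def Uf (l : ℝ → ℝ) : E → E := fun p =>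
  (0, 0, 0, l p.2.2.1)

theorem ContDiff.hasDerivAt_of_top {f : ℝ → ℝ} (hf : ContDiff ℝ (⊤ : ℕ∞) f) (t : ℝ) :
    HasDerivAt f (deriv f t) t :=
  (hf.differentiable (by simp)).differentiableAt.hasDerivAt

theorem ContDiff.deriv_of_top {f : ℝ → ℝ} (hf : ContDiff ℝ (⊤ : ℕ∞) f) :
    ContDiff ℝ (⊤ : ℕ∞) (deriv f) :=
  (contDiff_infty_iff_deriv.1 hf).2

/-- `D T(f)(p)(v)` in coordinates. -/
theorem fderiv_Tf_apply {f : ℝ → ℝ} (hf : ContDiff ℝ (⊤ : ℕ∞) f) (x y t w a b c d : ℝ) :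
    fderiv ℝ (Tf f) (x, y, t, w) (a, b, c, d) =
      ((1/3) * (a * deriv f t + x * (deriv (deriv f) t * c))
        + (2/9) * (2 * y * b * deriv (deriv f) t + y ^ 2 * (deriv (deriv (deriv f)) t * c)),
       (2/3) * (b * deriv f t + y * (deriv (deriv f) t * c)),
       deriv f t * c,
       -((1/3) * (d * deriv f t + w * (deriv (deriv f) t * c))
         + (1/9) * (2 * x * a * deriv (deriv f) t + x ^ 2 * (deriv (deriv (deriv f)) t * c))
         + (4/27) * ((a * y ^ 2 + x * (2 * y * b)) * deriv (deriv (deriv f)) t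
           + x * y ^ 2 * (deriv (deriv (deriv (deriv f))) t * c))
         + (4/243) * (4 * y ^ 3 * b * deriv (deriv (deriv (deriv f))) t
           + y ^ 4 * (deriv (deriv (deriv (deriv (deriv f)))) t * c)))) := by
  have h1 := hf.deriv_of_top
  have h2 := h1.deriv_of_top
  have h3 := h2.deriv_of_top
  have h4 := h3.deriv_of_top
  have hdiff : DifferentiableAt ℝ (Tf f) (x, y, t, w) := by
    have d0 := hf.differentiable (by simp)
    have d1 := h1.differentiable (by simp)
    have d2 := h2.differentiable (by simp)
    have d3 := h3.differentiable (by simp)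
    have d4 := h4.differentiable (by simp)
    unfold Tf
    fun_prop
  have line (u v : ℝ) : HasDerivAt (fun s : ℝ => u + s * v) v 0 := by
    simpa using ((hasDerivAt_id (0 : ℝ)).mul_const v).const_add u
  have comp {g : ℝ → ℝ} (hg : ContDiff ℝ (⊤ : ℕ∞) g) :
      HasDerivAt (fun s : ℝ => g (t + s * c)) (deriv g t * c) 0 :=
    HasDerivAt.comp (0 : ℝ) (by simpa using hg.hasDerivAt_of_top t) (line t c)
  have hx := line x a
  have hy := line y b
  have hw := line w d
  rw [← hdiff.lineDeriv_eq_fderiv]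
  refine HasDerivAt.deriv ?_
  have key := (((hx.const_mul (1/3)).mul (comp h1)).add
      (((hy.pow 2).const_mul (2/9)).mul (comp h2))).prodMk
    (((hy.const_mul (2/3)).mul (comp h1)).prodMk
    ((comp hf).prodMk
    (((((hw.const_mul (1/3)).mul (comp h1)).add
      (((hx.pow 2).const_mul (1/9)).mul (comp h2))).add
      (((hx.const_mul (4/27)).mul (hy.pow 2)).mul (comp h3))).add
      (((hy.pow 4).const_mul (4/243)).mul (comp h4))).neg))
  refine key.congr_deriv ?_
  simp only [zero_mul, add_zero, Pi.mul_apply, Pi.pow_apply]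
  ext <;> push_cast <;> ring

theorem deriv_mul_sub_mul {a b c d : ℝ → ℝ} (ha : ContDiff ℝ (⊤ : ℕ∞) a)
    (hb : ContDiff ℝ (⊤ : ℕ∞) b) (hc : ContDiff ℝ (⊤ : ℕ∞) c) (hd : ContDiff ℝ (⊤ : ℕ∞) d) :
    deriv (fun t => a t * b t - c t * d t) =
      fun t => (deriv a t * b t + a t * deriv b t) - (deriv c t * d t + c t * deriv d t) :=
  funext fun t => (((ha.hasDerivAt_of_top t).mul (hb.hasDerivAt_of_top t)).sub
    ((hc.hasDerivAt_of_top t).mul (hd.hasDerivAt_of_top t))).deriv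

/-- `[T(f₁), T(f₂)] = T(f₁f₂' − f₁'f₂)`: the `T(f)` form a centerless Virasoro algebra. -/
theorem stmt5 (f₁ f₂ : ℝ → ℝ) (hf₁ : ContDiff ℝ (⊤ : ℕ∞) f₁) (hf₂ : ContDiff ℝ (⊤ : ℕ∞) f₂) :
    ∀ p : E, lie (Tf f₁) (Tf f₂) p
      = Tf (fun t => f₁ t * deriv f₂ t - deriv f₁ t * f₂ t) p := by
  rintro ⟨x, y, t, w⟩
  have a1 := hf₁.deriv_of_top
  have a2 := a1.deriv_of_top
  have a3 := a2.deriv_of_top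
  have b1 := hf₂.deriv_of_top
  have b2 := b1.deriv_of_top
  have b3 := b2.deriv_of_top
  have e1 : deriv (fun t => f₁ t * deriv f₂ t - deriv f₁ t * f₂ t) =
      fun t => f₁ t * deriv (deriv f₂) t - deriv (deriv f₁) t * f₂ t := by
    rw [deriv_mul_sub_mul hf₁ b1 a1 hf₂]
    ext t
    ring
  have e2 : deriv (fun t => f₁ t * deriv (deriv f₂) t - deriv (deriv f₁) t * f₂ t) =
      fun t => (deriv f₁ t * deriv (deriv f₂) t - deriv (deriv f₁) t * deriv f₂ t)
        + (f₁ t * deriv (deriv (deriv f₂)) t - deriv (deriv (deriv f₁)) t * f₂ t) := by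
    rw [deriv_mul_sub_mul hf₁ b2 a2 hf₂]
    ext t
    ring
  have e3 : deriv (fun t => (deriv f₁ t * deriv (deriv f₂) t - deriv (deriv f₁) t * deriv f₂ t)
        + (f₁ t * deriv (deriv (deriv f₂)) t - deriv (deriv (deriv f₁)) t * f₂ t)) =
      fun t => 2 * (deriv f₁ t * deriv (deriv (deriv f₂)) t
          - deriv (deriv (deriv f₁)) t * deriv f₂ t)
        + (f₁ t * deriv (deriv (deriv (deriv f₂))) t
          - deriv (deriv (deriv (deriv f₁))) t * f₂ t) := by
    ext t
    refine (((((a1.hasDerivAt_of_top t).mul (b2.hasDerivAt_of_top t)).sub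
      ((a2.hasDerivAt_of_top t).mul (b1.hasDerivAt_of_top t))).add
      (((hf₁.hasDerivAt_of_top t).mul (b3.hasDerivAt_of_top t)).sub
      ((a3.hasDerivAt_of_top t).mul (hf₂.hasDerivAt_of_top t))))).deriv.trans ?_
    ring
  have a4 := a3.deriv_of_top
  have b4 := b3.deriv_of_top
  have e4 : deriv (fun t => 2 * (deriv f₁ t * deriv (deriv (deriv f₂)) t
          - deriv (deriv (deriv f₁)) t * deriv f₂ t)
        + (f₁ t * deriv (deriv (deriv (deriv f₂))) t
          - deriv (deriv (deriv (deriv f₁))) t * f₂ t)) =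
      fun t => 2 * (deriv (deriv f₁) t * deriv (deriv (deriv f₂)) t
          - deriv (deriv (deriv f₁)) t * deriv (deriv f₂) t)
        + 3 * (deriv f₁ t * deriv (deriv (deriv (deriv f₂))) t
          - deriv (deriv (deriv (deriv f₁))) t * deriv f₂ t)
        + (f₁ t * deriv (deriv (deriv (deriv (deriv f₂)))) t
          - deriv (deriv (deriv (deriv (deriv f₁)))) t * f₂ t) := by
    ext t
    refine ((((((a1.hasDerivAt_of_top t).mul (b3.hasDerivAt_of_top t)).sub
      ((a3.hasDerivAt_of_top t).mul (b1.hasDerivAt_of_top t))).const_mul 2).add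
      (((hf₁.hasDerivAt_of_top t).mul (b4.hasDerivAt_of_top t)).sub
      ((a4.hasDerivAt_of_top t).mul (hf₂.hasDerivAt_of_top t))))).deriv.trans ?_
    ring
  have hT (f : ℝ → ℝ) (q : E) : Tf f q = ((Tf f q).1, (Tf f q).2.1, (Tf f q).2.2.1,
    (Tf f q).2.2.2) := rfl
  unfold lie
  rw [hT f₁, hT f₂, fderiv_Tf_apply hf₁, fderiv_Tf_apply hf₂]
  simp only [Tf, e1, e2, e3, e4]
  ext <;> simp only [Prod.fst_sub, Prod.snd_sub] <;> ring
end
end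

section
/- For all smooth f, k : ℝ → ℝ, the Lie bracket of the vector fields T(f) and W(k) on ℝ⁴ satisfies [T(f), W(k)] = W(f·k' + f'·k) pointwise. -/
noncomputable section

theorem ContDiff.deriv_of_top_s12 {g : ℝ → ℝ} (hg : ContDiff ℝ (⊤ : ℕ∞) g) :
    ContDiff ℝ (⊤ : ℕ∞) (deriv g) :=
  (contDiff_infty_iff_deriv.1 hg).2

theorem ContDiff.differentiable_of_top {g : ℝ → ℝ} (hg : ContDiff ℝ (⊤ : ℕ∞) g) :
    Differentiable ℝ g :=
  (contDiff_infty_iff_deriv.1 hg).1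

theorem differentiable_Wf {k : ℝ → ℝ} (hk : Differentiable ℝ k) : Differentiable ℝ (Wf k) := by
  unfold Wf
  fun_prop

theorem differentiable_Tf {f : ℝ → ℝ} (hf : ContDiff ℝ (⊤ : ℕ∞) f) :
    Differentiable ℝ (Tf f) := by
  have h0 := hf.differentiable_of_top
  have h1 := hf.deriv_of_top_s12.differentiable_of_top
  have h2 := hf.deriv_of_top_s12.deriv_of_top_s12.differentiable_of_top
  have h3 := hf.deriv_of_top_s12.deriv_of_top_s12.deriv_of_top_s12.differentiable_of_top
  have h4 := hf.deriv_of_top_s12.deriv_of_top_s12.deriv_of_top_s12.deriv_of_top_s12.differentiable_of_top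
  unfold Tf
  fun_prop

theorem fderiv_Wf_apply {k : ℝ → ℝ} (hk : Differentiable ℝ k) (p v : E) :
    fderiv ℝ (Wf k) p v =
      (0, 0, 0, v.2.1 * k p.2.2.1 + p.2.1 * (deriv k p.2.2.1 * v.2.2.1)) := by
  rw [← (differentiable_Wf hk p).lineDeriv_eq_fderiv]
  refine HasLineDerivAt.lineDeriv ?_
  have hline (a b : ℝ) : HasDerivAt (fun s : ℝ => a + s * b) b 0 := by
    simpa using ((hasDerivAt_id (0 : ℝ)).mul_const b).const_add a
  have hcomp : HasDerivAt (fun s : ℝ => k (p.2.2.1 + s * v.2.2.1))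
      (deriv k p.2.2.1 * v.2.2.1) 0 := by
    refine HasDerivAt.comp (h₂ := k) 0 ?_ (hline p.2.2.1 v.2.2.1)
    simpa using (hk p.2.2.1).hasDerivAt
  have hlast := (hline p.2.1 v.2.1).mul hcomp
  simp only [zero_mul, add_zero] at hlast
  exact (hasDerivAt_const 0 0).prodMk
    ((hasDerivAt_const 0 0).prodMk ((hasDerivAt_const 0 0).prodMk hlast))

/-- The field `T(f)` is affine in the coordinate `w`. -/
theorem fderiv_Tf_apply_vertical {f : ℝ → ℝ} (hf : ContDiff ℝ (⊤ : ℕ∞) f) (p : E) (c : ℝ) :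
    fderiv ℝ (Tf f) p (0, 0, 0, c) = (0, 0, 0, -((1/3) * c * deriv f p.2.2.1)) := by
  rw [← (differentiable_Tf hf p).lineDeriv_eq_fderiv]
  refine HasLineDerivAt.lineDeriv ?_
  have haffine : (fun s : ℝ => Tf f (p + s • ((0, 0, 0, c) : E))) = fun s : ℝ =>
      Tf f p + s • ((0, 0, 0, -((1/3) * c * deriv f p.2.2.1)) : E) := by
    funext s
    simp only [Tf, Prod.fst_add, Prod.snd_add, Prod.smul_mk, smul_eq_mul, mul_zero, add_zero,
      Prod.mk_add_mk, Prod.mk.injEq, true_and]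
    ring
  unfold HasLineDerivAt
  rw [haffine]
  simpa using ((hasDerivAt_id (0 : ℝ)).smul_const
    ((0, 0, 0, -((1/3) * c * deriv f p.2.2.1)) : E)).const_add (Tf f p)

/-- `[T(f), W(k)] = W(f·k' + f'·k)`. -/
theorem stmt12 (f k : ℝ → ℝ) (hf : ContDiff ℝ (⊤ : ℕ∞) f) (hk : ContDiff ℝ (⊤ : ℕ∞) k) :
    ∀ p : E, lie (Tf f) (Wf k) p
      = Wf (fun t => f t * deriv k t + deriv f t * k t) p := by
  intro p
  have hT := fderiv_Tf_apply_vertical hf p (p.2.1 * k p.2.2.1)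
  rw [lie, fderiv_Wf_apply hk.differentiable_of_top]
  simp only [Wf] at hT ⊢
  rw [hT]
  simp only [Tf, Prod.mk_sub_mk, sub_zero, Prod.mk.injEq, true_and]
  ring
end
end
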